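/- arXiv:1306.4766 — 2 statements merged into one kernel-verified Lean document; each statement's English description precedes it below -/
import Mathlib

section
/- For every ε ∈ ℚ₂ with ‖ε‖ = 1/4 (i.e., ε is 4 times a 2-adic unit), there exist a, b ∈ ℤ₂ such that, setting α = a + b·ω ∈ ℍ[ℚ₂, 2, 5], the value N(1 + ε·α²) is nonzero and is not a square in ℚ₂. (This is the key representation step in showing that a lattice ⟨q⟩⊥⟨εq⟩ with ν(ε) = ν(4) represents an element whose norm lies outside the square class of N(q).) -/
open Quaternion

noncomputable section

/-- `D` is the quaternion algebra `ℍ[ℚ₂, 2, 5]` with `i² = 2`, `j² = 5`, `i·j = -j·i`;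
this is the unique quaternion division algebra over `ℚ₂`. -/
abbrev D : Type := ℍ[ℚ_[2], 2, 5]

/-- The basis quaternion `i`. -/
def qi : D := ⟨0, 1, 0, 0⟩

/-- The basis quaternion `j`. -/
def qj : D := ⟨0, 0, 1, 0⟩

/-- `ω = (1 + j)/2`. -/
def qω : D := ⟨1/2, 0, 1/2, 0⟩

/-- The reduced norm `N(q) = q · (star q)` (as a scalar). -/
def qN (q : D) : ℚ_[2] := (q * star q).re

/-- The reduced trace `T(q) = q + star q = 2·q.re` (as a scalar). -/
def qT (q : D) : ℚ_[2] := 2 * q.re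

theorem qN_val (ε : ℚ_[2]) :
    qN (1 + algebraMap ℚ_[2] D ε *
        (algebraMap ℚ_[2] D 0 + algebraMap ℚ_[2] D 1 * qω) ^ 2) = 1 + 3 * ε + ε ^ 2 := by
  have h : (1 + algebraMap ℚ_[2] D ε *
      (algebraMap ℚ_[2] D 0 + algebraMap ℚ_[2] D 1 * qω) ^ 2) = ⟨1 + 3 / 2 * ε, 0, ε / 2, 0⟩ := by
    rw [map_zero, map_one, zero_add, one_mul, QuaternionAlgebra.algebraMap_eq, pow_two]
    ext <;> simp [qω] <;> ring
  rw [h]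
  simp [qN]
  ring

theorem key_zmod : ∀ u v c : ZMod (2 ^ 3), u * v = 1 → c ^ 2 ≠ 1 + 12 * u + 16 * u ^ 2 := by
  decide

theorem not_sq (ε : ℚ_[2]) (hε : ‖ε‖ = 1 / 4) (c : ℚ_[2]) : 1 + 3 * ε + ε ^ 2 ≠ c ^ 2 := by
  intro h
  have h0 : ε ≠ 0 := by rintro rfl; norm_num at hε
  have h2 : ‖(2 : ℚ_[2])‖ = 1 / 2 := by
    have := Padic.norm_p (p := 2)
    norm_num at this ⊢
    exact this
  have h4 : ‖(4 : ℚ_[2])‖ = 1 / 4 := by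
    rw [show (4 : ℚ_[2]) = 2 * 2 by norm_num, norm_mul, h2]; norm_num
  have hu : ‖ε / 4‖ ≤ 1 := by rw [norm_div, hε, h4]; norm_num
  have hv : ‖4 / ε‖ ≤ 1 := by rw [norm_div, hε, h4]; norm_num
  let u : ℤ_[2] := ⟨ε / 4, hu⟩
  let v : ℤ_[2] := ⟨4 / ε, hv⟩
  let w : ℤ_[2] := 1 + 12 * u + 16 * u ^ 2
  have hw : (w : ℚ_[2]) = c ^ 2 := by
    rw [← h]
    change 1 + 12 * (ε / 4) + 16 * (ε / 4) ^ 2 = _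
    ring
  have hc : ‖c‖ ≤ 1 := by
    have h1 : ‖c‖ ^ 2 ≤ 1 := by rw [← norm_pow, ← hw]; exact w.2
    exact (sq_le_one_iff₀ (norm_nonneg c)).1 h1
  let d : ℤ_[2] := ⟨c, hc⟩
  have e1 : d ^ 2 = 1 + 12 * u + 16 * u ^ 2 := by
    apply Subtype.ext
    exact hw.symm
  have e2 : u * v = 1 := by
    apply Subtype.ext
    change ε / 4 * (4 / ε) = 1
    field_simp
  have f1 := congrArg (PadicInt.toZModPow (p := 2) 3) e1
  have f2 := congrArg (PadicInt.toZModPow (p := 2) 3) e2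
  simp only [map_add, map_mul, map_pow, map_one, map_ofNat] at f1 f2
  exact key_zmod _ _ _ f2 f1

/-- For any `ε ∈ ℚ₂` with `‖ε‖ = 1/4` there exist `a, b ∈ ℤ₂` such that, with
`α = a + b·ω`, the value `N(1 + ε·α²)` is nonzero and is not a square in `ℚ₂`. -/
theorem stmt_14 (ε : ℚ_[2]) (hε : ‖ε‖ = 1 / 4) :
    ∃ a b : ℚ_[2], ‖a‖ ≤ 1 ∧ ‖b‖ ≤ 1 ∧
      qN (1 + algebraMap ℚ_[2] D ε *
        (algebraMap ℚ_[2] D a + algebraMap ℚ_[2] D b * qω) ^ 2) ≠ 0 ∧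
      ¬ ∃ c : ℚ_[2], qN (1 + algebraMap ℚ_[2] D ε *
        (algebraMap ℚ_[2] D a + algebraMap ℚ_[2] D b * qω) ^ 2) = c ^ 2 := by
  refine ⟨0, 1, by simp, by simp, ?_, ?_⟩
  · rw [qN_val]
    intro h
    exact not_sq ε hε 0 (by rw [h]; ring)
  · rintro ⟨c, h⟩
    rw [qN_val] at h
    exact not_sq ε hε c h
end
end

section
/- Let ε ∈ ℚ₂ with ‖ε‖ = 1 and let ξ ∈ ℍ[ℚ₂, 2, 5] with ‖N(ξ)‖ ≤ 1 and ‖T(ξ)‖ ≤ 1 (so ξ is integral). Then N(1 + 4·ε·ξ) is a square in ℚ₂ if and only if ‖T(ξ)‖ ≤ 1/2 (i.e., the reduced trace of ξ is divisible by 2 in ℤ₂). -/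
open Quaternion

noncomputable section

lemma qN_expand (a : ℚ_[2]) (ξ : D) :
    qN (1 + algebraMap ℚ_[2] D a * ξ) = 1 + a * qT ξ + a ^ 2 * qN ξ := by
  have h : algebraMap ℚ_[2] D a = ⟨a, 0, 0, 0⟩ := by
    ext <;> simp [QuaternionAlgebra.algebraMap_eq]
  rw [h]
  simp [qN, qT]
  ring

lemma two_dvd_iff (x : ℤ_[2]) : (2 : ℤ_[2]) ∣ x ↔ PadicInt.toZMod x = 0 := by
  rw [← RingHom.mem_ker, PadicInt.ker_toZMod, PadicInt.maximalIdeal_eq_span_p,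
    Ideal.mem_span_singleton]
  norm_num

lemma norm_half_iff (x : ℤ_[2]) : ‖x‖ ≤ 1 / 2 ↔ (2 : ℤ_[2]) ∣ x := by
  have := PadicInt.norm_le_pow_iff_mem_span_pow x 1
  rw [Ideal.mem_span_singleton] at this
  norm_num at this
  norm_num
  exact this

lemma exists_root (m : ℤ_[2]) (hm : (2 : ℤ_[2]) ∣ m) : ∃ d : ℤ_[2], d ^ 2 + d = m := by
  open Polynomial in
  have h1 : ‖m‖ < 1 := lt_of_le_of_lt ((norm_half_iff m).2 hm) (by norm_num)
  obtain ⟨z, hz, -⟩ := hensels_lemma (p := 2) (R := ℤ_[2])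
    (F := Polynomial.X ^ 2 + Polynomial.X - Polynomial.C m) (a := 0) (by simpa using h1)
  refine ⟨z, ?_⟩
  simp at hz
  linear_combination hz

theorem stmt_15 (ε : ℚ_[2]) (hε : ‖ε‖ = 1) (ξ : D)
    (hN : ‖qN ξ‖ ≤ 1) (hT : ‖qT ξ‖ ≤ 1) :
    (∃ c : ℚ_[2], qN (1 + algebraMap ℚ_[2] D (4 * ε) * ξ) = c ^ 2) ↔
      ‖qT ξ‖ ≤ 1 / 2 := by
  rw [qN_expand]
  generalize qN ξ = n at *
  generalize qT ξ = t at *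
  obtain ⟨n, rfl⟩ : ∃ x : ℤ_[2], (x : ℚ_[2]) = n := ⟨⟨n, hN⟩, rfl⟩
  obtain ⟨t, rfl⟩ : ∃ x : ℤ_[2], (x : ℚ_[2]) = t := ⟨⟨t, hT⟩, rfl⟩
  obtain ⟨e, rfl⟩ : ∃ e : ℤ_[2], (e : ℚ_[2]) = ε := ⟨⟨ε, hε.le⟩, rfl⟩
  have he : IsUnit e := PadicInt.isUnit_iff.2 hε
  change _ ↔ ‖t‖ ≤ 1 / 2
  rw [norm_half_iff]
  constructor
  · rintro ⟨c, hc⟩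
    have hc' : c ^ 2 = ((1 + 4 * e * t + (4 * e) ^ 2 * n : ℤ_[2]) : ℚ_[2]) := by
      rw [← hc]; push_cast; rfl
    have hcn : ‖c‖ ≤ 1 := by
      have : ‖c‖ ^ 2 ≤ 1 := by
        rw [← norm_pow, hc']; exact PadicInt.norm_le_one _
      exact (pow_le_one_iff_of_nonneg (norm_nonneg _) two_ne_zero).1 this
    obtain ⟨c, rfl⟩ : ∃ x : ℤ_[2], (x : ℚ_[2]) = c := ⟨⟨c, hcn⟩, rfl⟩
    have hc2 : c ^ 2 = 1 + 4 * e * t + (4 * e) ^ 2 * n := by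
      apply Subtype.coe_injective
      exact_mod_cast hc'
    have h4 : (4 : ZMod 2) = 0 := rfl
    have h1 := congrArg (PadicInt.toZMod (p := 2)) hc2
    simp only [map_add, map_mul, map_pow, map_one, map_ofNat, h4] at h1
    obtain ⟨d, hd⟩ : (2 : ℤ_[2]) ∣ c - 1 := by
      rw [two_dvd_iff, map_sub, map_one]
      generalize PadicInt.toZMod c = x at h1
      generalize PadicInt.toZMod e = y at h1
      generalize PadicInt.toZMod t = z at h1
      generalize PadicInt.toZMod n = w at h1
      revert x y z w; decide
    have h5 : d ^ 2 + d = e * t + 4 * e ^ 2 * n := by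
      have h40 : (4 : ℤ_[2]) ≠ 0 := by norm_num
      apply mul_left_cancel₀ h40
      have : c = 1 + 2 * d := by linear_combination hd
      subst this
      linear_combination hc2
    have h6 : (2 : ℤ_[2]) ∣ e * t := by
      have h1 := congrArg (PadicInt.toZMod (p := 2)) h5
      simp only [map_add, map_mul, map_pow, map_ofNat, h4] at h1
      rw [two_dvd_iff, map_mul]
      generalize PadicInt.toZMod d = x at h1
      generalize PadicInt.toZMod e = y at *
      generalize PadicInt.toZMod t = z at *
      generalize PadicInt.toZMod n = w at h1
      clear * - h1
      revert x y z w; decide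
    exact (he.dvd_mul_left).1 h6
  · intro h
    obtain ⟨d, hd⟩ := exists_root (e * t + 4 * e ^ 2 * n)
      (dvd_add (h.mul_left _) ⟨2 * e ^ 2 * n, by ring⟩)
    refine ⟨((1 + 2 * d : ℤ_[2]) : ℚ_[2]), ?_⟩
    have : (1 + 4 * e * t + (4 * e) ^ 2 * n : ℤ_[2]) = (1 + 2 * d) ^ 2 := by
      linear_combination -4 * hd
    have := congrArg (fun x : ℤ_[2] => (x : ℚ_[2])) this
    push_cast at this ⊢
    exact this
end
end
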